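/- For all integers ℓ ≥ 0 and m ≥ 1: Σ_{j=0}^{⌊ℓ/2⌋} (2m+1+2ℓ−4j) · Γ(ℓ+2m−j+1/2)/Γ(ℓ+m−j+3/2) · (m)_j/j! · Γ(ℓ+2m−2j+1)/Γ(ℓ−2j+1) = 2√π Γ(ℓ+4m+1) / (16^m Γ(m+1/2) Γ(ℓ+1)). -/

import Mathlib

lemma Gamma_add_two {z : ℝ} (hz : 0 < z) :
    Real.Gamma (z + 2) = (z + 1) * (z * Real.Gamma z) := by
  rw [← Real.Gamma_add_one hz.ne', ← Real.Gamma_add_one (by positivity)]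
  ring_nf

open Real in
/-- The summand of the series, with real parameters `l` and `m`. -/
noncomputable def summand (l m : ℝ) (j : ℕ) : ℝ :=
  (2 * m + 1 + 2 * l - 4 * j) *
    (Gamma (l + 2 * m - j + 1 / 2) / Gamma (l + m - j + 3 / 2)) *
    ((ascPochhammer ℝ j).eval m / (Nat.factorial j : ℝ)) *
    (Gamma (l + 2 * m - 2 * j + 1) / Gamma (l - 2 * j + 1))

/-- The ratio of consecutive closed forms when `m` increases by one. -/
noncomputable def closedFormRatio (l m : ℝ) : ℝ :=
  (l + 4 * m + 1) * (l + 4 * m + 2) * (l + 4 * m + 3) * (l + 4 * m + 4) / (8 * (2 * m + 1))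

/-- The polynomial part of the Gosper certificate for the recurrence in `m`. -/
noncomputable def certificatePoly (l m t : ℝ) : ℝ :=
  (8 * (2 * m + 1) * t ^ 3
    - (40 + 112 * m + 64 * m ^ 2 + 16 * l + 32 * l * m) * t ^ 2
    + (66 + 216 * m + 200 * m ^ 2 + 48 * m ^ 3 + 54 * l + 134 * l * m + 64 * l * m ^ 2
      + 10 * l ^ 2 + 18 * l ^ 2 * m) * t
    + (-36 - 102 * m - 36 * m ^ 2 + 96 * m ^ 3 + 64 * m ^ 4 - 45 * l - 99 * l * m
      - 22 * l * m ^ 2 + 32 * l * m ^ 3 - 17 * l ^ 2 - 27 * l ^ 2 * m - 2 * l ^ 2 * m ^ 2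
      - 2 * l ^ 3 - 2 * l ^ 3 * m)) / (8 * (2 * m + 1) * (m + 1))

open Real in
/-- The antidifference of `summand l (m + 1) j - closedFormRatio l m * summand l m j`. -/
noncomputable def antidifference (l m : ℝ) (j : ℕ) : ℝ :=
  (l + m - j + 3 / 2) * (l - 2 * j) * (l - 2 * j - 1) * certificatePoly l m (j + 1) *
    (Gamma (l + 2 * m - j + 1 / 2) / Gamma (l + m - j + 5 / 2)) *
    ((ascPochhammer ℝ j).eval (m + 1) / (Nat.factorial j : ℝ)) *
    (Gamma (l + 2 * m - 2 * j + 1) / Gamma (l - 2 * j + 1))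

lemma summand_zero_sub (l m : ℝ) (hl : 0 ≤ l) (hm : 0 ≤ m) :
    summand l (m + 1) 0 - closedFormRatio l m * summand l m 0 = antidifference l m 0 := by
  have e1 : Real.Gamma (l + 2 * (m + 1) + 1 / 2) =
      (l + 2 * m + 3 / 2) * ((l + 2 * m + 1 / 2) * Real.Gamma (l + 2 * m + 1 / 2)) := by
    rw [show l + 2 * (m + 1) + 1 / 2 = l + 2 * m + 1 / 2 + 2 by ring,
      Gamma_add_two (by positivity)]
    ring
  have e2 : Real.Gamma (l + m + 5 / 2) = (l + m + 3 / 2) * Real.Gamma (l + m + 3 / 2) := by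
    rw [← Real.Gamma_add_one (by positivity)]
    ring_nf
  have e2' : Real.Gamma (l + (m + 1) + 3 / 2) = (l + m + 3 / 2) * Real.Gamma (l + m + 3 / 2) := by
    rw [← Real.Gamma_add_one (by positivity)]
    ring_nf
  have e3 : Real.Gamma (l + 2 * (m + 1) + 1) =
      (l + 2 * m + 2) * ((l + 2 * m + 1) * Real.Gamma (l + 2 * m + 1)) := by
    rw [show l + 2 * (m + 1) + 1 = l + 2 * m + 1 + 2 by ring, Gamma_add_two (by positivity)]
    ring
  have h1 : Real.Gamma (l + m + 3 / 2) ≠ 0 := (Real.Gamma_pos_of_pos (by positivity)).ne'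
  have h2 : Real.Gamma (l + 1) ≠ 0 := (Real.Gamma_pos_of_pos (by positivity)).ne'
  have h3 : l + m + 3 / 2 ≠ 0 := by positivity
  simp only [summand, antidifference, closedFormRatio, certificatePoly, Nat.cast_zero, mul_zero,
    sub_zero, ascPochhammer_zero, Polynomial.eval_one, Nat.factorial_zero, Nat.cast_one, e1, e2,
    e2', e3, zero_add]
  generalize Real.Gamma (l + m + 3 / 2) = g₁ at *
  generalize Real.Gamma (l + 1) = g₂ at *
  generalize Real.Gamma (l + 2 * m + 1) = g₃ at *
  generalize Real.Gamma (l + 2 * m + 1 / 2) = g₄ at *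
  clear e1 e2 e2' e3
  field_simp
  ring

lemma summand_succ_sub (l m : ℝ) (j : ℕ) (hm : 0 ≤ m) (hj : 2 * ((j : ℝ) + 1) ≤ l) :
    summand l (m + 1) (j + 1) - closedFormRatio l m * summand l m (j + 1) =
      antidifference l m (j + 1) - antidifference l m j := by
  obtain ⟨k, hk, rfl⟩ : ∃ k : ℝ, 0 ≤ k ∧ l = k + 2 * (j + 1) := ⟨_, sub_nonneg.2 hj, by ring⟩
  have hj0 : (0 : ℝ) ≤ j := Nat.cast_nonneg j
  set x : ℝ := k + j + 2 * m + 3 / 2 with hx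
  set y : ℝ := k + j + m + 5 / 2 with hy
  have hx0 : 0 < x := by positivity
  have hy0 : 0 < y := by positivity
  have hP₁ : (ascPochhammer ℝ (j + 1)).eval (m + 1) =
      (ascPochhammer ℝ j).eval (m + 1) * (m + 1 + j) := ascPochhammer_succ_eval j (m + 1)
  have hP₀ : (ascPochhammer ℝ (j + 1)).eval m = m * (ascPochhammer ℝ j).eval (m + 1) := by
    simp [ascPochhammer_succ_left, Polynomial.eval_comp]
  have hG : ∀ z : ℝ, 0 < z → Real.Gamma (z + 1) = z * Real.Gamma z :=
    fun z hz ↦ Real.Gamma_add_one hz.ne'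
  have a1 : Real.Gamma (k + 2 * (j + 1) + 2 * (m + 1) - (j + 1) + 1 / 2) =
      (x + 1) * (x * Real.Gamma x) := by
    rw [← Gamma_add_two hx0, hx]
    ring_nf
  have a2 : k + 2 * (j + 1) + 2 * m - (j + 1) + 1 / 2 = x := by rw [hx]; ring
  have a3 : Real.Gamma (k + 2 * (j + 1) + 2 * m - j + 1 / 2) = x * Real.Gamma x := by
    rw [← hG x hx0, hx]
    ring_nf
  have b1 : k + 2 * (j + 1) + (m + 1) - (j + 1) + 3 / 2 = y + 1 := by rw [hy]; ring
  have b2 : k + 2 * (j + 1) + m - (j + 1) + 3 / 2 = y := by rw [hy]; ring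
  have b3 : k + 2 * (j + 1) + m - (j + 1) + 5 / 2 = y + 1 := by rw [hy]; ring
  have b4 : k + 2 * (j + 1) + m - j + 5 / 2 = y + 1 + 1 := by rw [hy]; ring
  have b5 : k + 2 * (j + 1) + m - j + 3 / 2 = y + 1 := by rw [hy]; ring
  have c1 : Real.Gamma (k + 2 * (j + 1) + 2 * (m + 1) - 2 * (j + 1) + 1) =
      (k + 2 * m + 2) * ((k + 2 * m + 1) * Real.Gamma (k + 2 * m + 1)) := by
    rw [show k + 2 * (j + 1) + 2 * (m + 1) - 2 * (j + 1) + 1 = k + 2 * m + 1 + 2 by ring,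
      Gamma_add_two (by positivity)]
    ring
  have c2 : k + 2 * (j + 1) + 2 * m - 2 * (j + 1) + 1 = k + 2 * m + 1 := by ring
  have c3 : Real.Gamma (k + 2 * (j + 1) + 2 * m - 2 * j + 1) =
      (k + 2 * m + 2) * ((k + 2 * m + 1) * Real.Gamma (k + 2 * m + 1)) := by
    rw [show k + 2 * (j + 1) + 2 * m - 2 * j + 1 = k + 2 * m + 1 + 2 by ring,
      Gamma_add_two (by positivity)]
    ring
  have d1 : k + 2 * (j + 1) - 2 * (j + 1) + 1 = k + 1 := by ring
  have d2 : Real.Gamma (k + 2 * (j + 1) - 2 * j + 1) =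
      (k + 2) * ((k + 1) * Real.Gamma (k + 1)) := by
    rw [show k + 2 * (j + 1) - 2 * j + 1 = k + 1 + 2 by ring, Gamma_add_two (by positivity)]
    ring
  have h1 : Real.Gamma y ≠ 0 := (Real.Gamma_pos_of_pos hy0).ne'
  have h2 : Real.Gamma (k + 1) ≠ 0 := (Real.Gamma_pos_of_pos (by positivity)).ne'
  have h3 : (Nat.factorial j : ℝ) ≠ 0 := by positivity
  simp only [summand, antidifference, closedFormRatio, certificatePoly, Nat.cast_succ,
    Nat.factorial_succ, Nat.cast_mul, hP₀, hP₁, a1, a2, a3, b1, b2, b3, b4, b5, c1, c2, c3, d1, d2,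
    hG (y + 1) (by positivity), hG y hy0]
  clear a1 a2 a3 b1 b2 b3 b4 b5 c1 c2 c3 d1 d2 hP₀ hP₁ hG hj
  generalize Real.Gamma y = g₁ at *
  generalize Real.Gamma (k + 1) = g₂ at *
  generalize Real.Gamma (k + 2 * m + 1) = g₃ at *
  generalize Real.Gamma x = g₄ at *
  generalize (ascPochhammer ℝ j).eval (m + 1) = P at *
  generalize (Nat.factorial j : ℝ) = f at *
  generalize (j : ℝ) = t at *
  have hy1 : y + 1 ≠ 0 := by positivity
  field_simp
  rw [hx, hy]
  ring

lemma sum_summand_sub (l m : ℝ) (J : ℕ) (hm : 0 ≤ m) (hJ : 2 * (J : ℝ) ≤ l) :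
    ∑ j ∈ Finset.range (J + 1), (summand l (m + 1) j - closedFormRatio l m * summand l m j) =
      antidifference l m J := by
  induction J with
  | zero => simpa using summand_zero_sub l m (by simpa using hJ) hm
  | succ J ih =>
    push_cast at hJ
    rw [Finset.sum_range_succ, ih (by linarith), summand_succ_sub l m J hm hJ]
    ring

lemma antidifference_half (ℓ : ℕ) (m : ℝ) : antidifference ℓ m (ℓ / 2) = 0 := by
  rcases Nat.even_or_odd' ℓ with ⟨n, rfl | rfl⟩
  · have h : 2 * n / 2 = n := by lia
    simp [antidifference, h]
  · have h : (2 * n + 1) / 2 = n := by lia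
    simp [antidifference, h]

lemma sum_summand_succ (ℓ : ℕ) (m : ℝ) (hm : 0 ≤ m) :
    ∑ j ∈ Finset.range (ℓ / 2 + 1), summand ℓ (m + 1) j =
      closedFormRatio ℓ m * ∑ j ∈ Finset.range (ℓ / 2 + 1), summand ℓ m j := by
  have hℓ : 2 * ((ℓ / 2 : ℕ) : ℝ) ≤ ℓ := by exact_mod_cast Nat.mul_div_le ℓ 2
  have h := sum_summand_sub ℓ m (ℓ / 2) hm hℓ
  rw [antidifference_half, Finset.sum_sub_distrib, ← Finset.mul_sum] at h
  exact sub_eq_zero.1 h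

lemma sum_summand_zero (ℓ : ℕ) : ∑ j ∈ Finset.range (ℓ / 2 + 1), summand ℓ 0 j = 2 := by
  rw [Finset.sum_range_succ', Finset.sum_eq_zero fun j _ ↦ by simp [summand]]
  have e : Real.Gamma ((ℓ : ℝ) + 3 / 2) = (ℓ + 1 / 2) * Real.Gamma ((ℓ : ℝ) + 1 / 2) := by
    rw [← Real.Gamma_add_one (by positivity)]
    ring_nf
  have h1 : Real.Gamma ((ℓ : ℝ) + 1 / 2) ≠ 0 := (Real.Gamma_pos_of_pos (by positivity)).ne'
  have h2 : Real.Gamma ((ℓ : ℝ) + 1) ≠ 0 := (Real.Gamma_pos_of_pos (by positivity)).ne'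
  simp only [summand, Nat.cast_zero, mul_zero, sub_zero, add_zero, zero_add, ascPochhammer_zero,
    Polynomial.eval_one, Nat.factorial_zero, Nat.cast_one, e]
  field_simp
  ring

lemma sum_summand (ℓ m : ℕ) :
    ∑ j ∈ Finset.range (ℓ / 2 + 1), summand ℓ m j =
      2 * Real.sqrt Real.pi * Real.Gamma ((ℓ : ℝ) + 4 * m + 1) /
        (16 ^ m * Real.Gamma ((m : ℝ) + 1 / 2) * Real.Gamma ((ℓ : ℝ) + 1)) := by
  have h2 : Real.Gamma ((ℓ : ℝ) + 1) ≠ 0 := (Real.Gamma_pos_of_pos (by positivity)).ne'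
  induction m with
  | zero =>
    have hπ : Real.sqrt Real.pi ≠ 0 := (Real.sqrt_pos.2 Real.pi_pos).ne'
    rw [Nat.cast_zero, sum_summand_zero, mul_zero, add_zero, zero_add, Real.Gamma_one_half_eq]
    field_simp
  | succ m ih =>
    have e1 : Real.Gamma ((m : ℝ) + 1 + 1 / 2) = (m + 1 / 2) * Real.Gamma ((m : ℝ) + 1 / 2) := by
      rw [← Real.Gamma_add_one (by positivity)]
      ring_nf
    have e2 : Real.Gamma ((ℓ : ℝ) + 4 * (m + 1) + 1) = (ℓ + 4 * m + 4) * ((ℓ + 4 * m + 3) *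
        ((ℓ + 4 * m + 2) * ((ℓ + 4 * m + 1) * Real.Gamma ((ℓ : ℝ) + 4 * m + 1)))) := by
      rw [← Real.Gamma_add_one (by positivity),
        show (ℓ : ℝ) + 4 * m + 1 + 1 = ℓ + 4 * m + 2 by ring, ← Real.Gamma_add_one (by positivity),
        show (ℓ : ℝ) + 4 * m + 2 + 1 = ℓ + 4 * m + 3 by ring, ← Real.Gamma_add_one (by positivity),
        show (ℓ : ℝ) + 4 * m + 3 + 1 = ℓ + 4 * m + 4 by ring, ← Real.Gamma_add_one (by positivity)]
      ring_nf
    have h1 : Real.Gamma ((m : ℝ) + 1 / 2) ≠ 0 := (Real.Gamma_pos_of_pos (by positivity)).ne'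
    rw [Nat.cast_succ, sum_summand_succ ℓ m (Nat.cast_nonneg m), ih, e1, e2, closedFormRatio]
    generalize Real.Gamma ((m : ℝ) + 1 / 2) = g₁ at *
    generalize Real.Gamma ((ℓ : ℝ) + 4 * m + 1) = g₃ at *
    field_simp
    ring


/-- For ℓ ≥ 0 and m ≥ 1:
∑_{j=0}^{⌊ℓ/2⌋} (2m+1+2ℓ−4j) Γ(ℓ+2m−j+1/2)/Γ(ℓ+m−j+3/2) (m)_j/j! Γ(ℓ+2m−2j+1)/Γ(ℓ−2j+1)
  = 2√π Γ(ℓ+4m+1) / (16^m Γ(m+1/2) Γ(ℓ+1)). -/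
theorem stmt5 (ℓ m : ℕ) (hm : 1 ≤ m) :
    ∑ j ∈ Finset.range (ℓ/2 + 1),
      (2*(m:ℝ)+1+2*(ℓ:ℝ)-4*(j:ℝ)) *
      (Real.Gamma ((ℓ:ℝ)+2*m-(j:ℝ)+1/2) / Real.Gamma ((ℓ:ℝ)+m-(j:ℝ)+3/2)) *
      ((ascPochhammer ℝ j).eval (m:ℝ) / (Nat.factorial j : ℝ)) *
      (Real.Gamma ((ℓ:ℝ)+2*m-2*(j:ℝ)+1) / Real.Gamma ((ℓ:ℝ)-2*(j:ℝ)+1)) =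
    2 * Real.sqrt Real.pi * Real.Gamma ((ℓ:ℝ)+4*m+1) /
      (16^m * Real.Gamma ((m:ℝ)+1/2) * Real.Gamma ((ℓ:ℝ)+1)) := by
  exact sum_summand ℓ m
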